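/- Let γ : [0,L] → ℝ² be a C² unit-speed curve with positive geodesic curvature, connecting (a,0) to (-a,0) where a > 0, such that the closed curve γ ⊕ [-a,a] (γ followed by the straight segment from (-a,0) to (a,0)) is simple. If γ'(0) = e^{iθ₀} with π/2 ≤ θ₀ < π and γ'(L) = e^{iθ_L} with π < θ_L ≤ 3π/2, then the tangent angle θ of γ satisfies θ(0) = θ₀, θ(L) = θ_L, θ is strictly increasing, θ(t) ∈ [θ₀, θ_L] for all t, and γ is a graph over the x₁-axis (i.e., t ↦ γ₁(t) is strictly monotone). -/

import Mathlib

open Real Set Complex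

/-- Real inner product on ℂ viewed as ℝ². -/
noncomputable def inner2 (x y : ℂ) : ℝ := x.re * y.re + x.im * y.im

/-- Signed geodesic curvature of a unit-speed planar curve (J = multiplication by I). -/
noncomputable def curvU (γ : ℝ → ℂ) (t : ℝ) : ℝ :=
  inner2 (deriv (deriv γ) t) (Complex.I * deriv γ t)

/-- Signed geodesic curvature of a regular planar curve. -/
noncomputable def curvR (γ : ℝ → ℂ) (t : ℝ) : ℝ :=
  (‖deriv γ t‖ ^ 3)⁻¹ * inner2 (deriv (deriv γ) t) (Complex.I * deriv γ t)

/-- The closed curve γ ⊕ [-a,a]: γ on [0,L] followed by the segment from (-a,0) to (a,0). -/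
noncomputable def concatSeg (γ : ℝ → ℂ) (L a : ℝ) : ℝ → ℂ :=
  fun t => if t ≤ L then γ t else Complex.ofReal (-a + (t - L))

/-- A continuous function on a preconnected set of reals whose values are integral multiples of
`2π` is constant. -/
lemma eq_of_continuousOn_of_forall_two_pi_int {f : ℝ → ℝ} {s : Set ℝ} (hs : IsPreconnected s)
    (hf : ContinuousOn f s) (hint : ∀ x ∈ s, ∃ n : ℤ, f x = 2 * π * n) {x y : ℝ}
    (hx : x ∈ s) (hy : y ∈ s) : f x = f y := by
  have key : ∀ x ∈ s, ∀ y ∈ s, ¬ f x < f y := by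
    intro x hx y hy hlt
    obtain ⟨m, hm⟩ := hint x hx
    obtain ⟨n, hn⟩ := hint y hy
    have hmn : m < n := by
      have : (m : ℝ) < n := by
        rw [hm, hn] at hlt
        exact lt_of_mul_lt_mul_left hlt (by positivity)
      exact_mod_cast this
    have hmn' : (m : ℝ) + 1 ≤ n := by exact_mod_cast hmn
    obtain ⟨z, hz, hfz⟩ := hs.intermediate_value hx hy hf
      (show 2 * π * (m + 1 / 2) ∈ Icc (f x) (f y) by
        rw [hm, hn]
        constructor <;> nlinarith [Real.pi_pos])
    obtain ⟨k, hk⟩ := hint z hz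
    have h2 : (k : ℝ) = m + 1 / 2 :=
      mul_left_cancel₀ (by positivity : (2 * π : ℝ) ≠ 0) (hk.symm.trans hfz)
    have h3 : (2 * k : ℤ) = 2 * m + 1 := by
      have : (2 * k : ℝ) = 2 * m + 1 := by linarith
      exact_mod_cast this
    omega
  exact le_antisymm (not_lt.1 (key y hy x hx)) (not_lt.1 (key x hx y hy))

/-- An angle function with nonnegative sine stays in `[0, π]`. -/
lemma mem_Icc_zero_pi_of_sin_nonneg {f : ℝ → ℝ} {s : Set ℝ} (hs : IsPreconnected s)
    (hf : ContinuousOn f s) (hsin : ∀ x ∈ s, 0 ≤ Real.sin (f x)) {x₀ x : ℝ} (hx₀ : x₀ ∈ s)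
    (h₀ : f x₀ ∈ Icc 0 π) (hx : x ∈ s) : f x ∈ Icc 0 π := by
  have hpi := Real.pi_pos
  constructor
  · by_contra! hlt
    obtain ⟨z, hz, hfz⟩ := hs.intermediate_value hx hx₀ hf
      (show max (f x) (-(π / 2)) ∈ Icc (f x) (f x₀) from
        ⟨le_max_left _ _, max_le (by linarith [h₀.1]) (by linarith [h₀.1])⟩)
    have h1 : f z < 0 := by rw [hfz]; exact max_lt hlt (by linarith)
    have h2 : -π < f z := by rw [hfz]; exact lt_max_of_lt_right (by linarith)
    exact absurd (hsin z hz) (not_le.2 (Real.sin_neg_of_neg_of_neg_pi_lt h1 h2))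
  · by_contra! hlt
    obtain ⟨z, hz, hfz⟩ := hs.intermediate_value hx₀ hx hf
      (show min (f x) (3 * π / 2) ∈ Icc (f x₀) (f x) from
        ⟨le_min (by linarith [h₀.2]) (by linarith [h₀.2]), min_le_left _ _⟩)
    have h1 : π < f z := by rw [hfz]; exact lt_min hlt (by linarith)
    have h2 : f z < 2 * π := by rw [hfz]; exact min_lt_of_right_lt (by linarith)
    have h3 := hsin z hz
    have h4 : Real.sin (f z - π) = -Real.sin (f z) := Real.sin_sub_pi _
    have h5 : 0 < Real.sin (f z - π) :=
      Real.sin_pos_of_pos_of_lt_pi (by linarith) (by linarith)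
    linarith

/-- A nowhere vanishing continuous function on the plane has a continuous logarithm. -/
lemma exists_continuous_exp_eq {F : ℝ × ℝ → ℂ} (hF : Continuous F) (hne : ∀ p, F p ≠ 0) :
    ∃ f : ℝ × ℝ → ℂ, Continuous f ∧ ∀ p, Complex.exp (f p) = F p := by
  obtain ⟨f, ⟨-, hf⟩, -⟩ := isCoveringMapOn_exp.existsUnique_continuousMap_lifts
    ⟨F, hF⟩ (Complex.exp_log (hne 0)) hne
  exact ⟨f, f.continuous, fun p => congrFun hf p⟩

lemma exp_mul_I_eq_iff_exists_int {x y : ℝ} :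
    Complex.exp ((x : ℂ) * Complex.I) = Complex.exp ((y : ℂ) * Complex.I) ↔
      ∃ n : ℤ, x - y = 2 * π * n := by
  rw [Complex.exp_eq_exp_iff_exists_int]
  refine exists_congr fun n => ⟨fun h => ?_, fun h => ?_⟩
  · have := congrArg Complex.im h
    simp at this
    linarith
  · have : x = y + 2 * π * n := by linarith
    rw [this]
    push_cast
    ring

lemma exp_mul_I_im (x : ℝ) : (Complex.exp ((x : ℂ) * Complex.I)).im = Real.sin x := by
  rw [Complex.exp_ofReal_mul_I_im]

/-- The averaged derivative of a curve is its difference quotient. -/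
lemma sub_mul_integral_deriv_segment {γ : ℝ → ℂ} (hγ : ContDiff ℝ 1 γ) (s t : ℝ) :
    ((t - s : ℝ) : ℂ) * ∫ u in (0 : ℝ)..1, deriv γ (s + u * (t - s)) = γ t - γ s := by
  have hd : ∀ x, HasDerivAt γ (deriv γ x) x := fun x =>
    (hγ.differentiable one_ne_zero x).hasDerivAt
  have hc : Continuous (deriv γ) := hγ.continuous_deriv le_rfl
  have hcomp : ∀ u : ℝ, HasDerivAt (fun u : ℝ => γ (s + u * (t - s)))
      ((t - s) • deriv γ (s + u * (t - s))) u := by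
    intro u
    have h1 : HasDerivAt (fun u : ℝ => s + u * (t - s)) (t - s) u := by
      simpa using ((hasDerivAt_id u).mul_const (t - s)).const_add s
    exact HasDerivAt.scomp u (hd _) h1
  have := intervalIntegral.integral_eq_sub_of_hasDerivAt (a := 0) (b := 1)
    (fun u _ => hcomp u) (Continuous.intervalIntegrable (by fun_prop) _ _)
  rw [intervalIntegral.integral_smul] at this
  simpa using this

/-- Hopf's secant angle: a regular simple arc with tangent angle `θ` admits a continuous angle
function for its secants which extends `θ` from the diagonal. -/
lemma exists_secant_angle {γ : ℝ → ℂ} {θ : ℝ → ℝ} {L : ℝ} (hL : 0 ≤ L) (hγ : ContDiff ℝ 1 γ)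
    (hinj : InjOn γ (Icc 0 L)) (hθ : ContinuousOn θ (Icc 0 L))
    (hlift : ∀ t ∈ Icc 0 L, deriv γ t = Complex.exp ((θ t : ℂ) * Complex.I)) :
    ∃ Φ R : ℝ × ℝ → ℝ, Continuous Φ ∧ (∀ p, 0 < R p) ∧ (∀ t ∈ Icc 0 L, Φ (t, t) = θ t) ∧
      ∀ s ∈ Icc 0 L, ∀ t ∈ Icc 0 L,
        γ t - γ s = (((t - s) * R (s, t) : ℝ) : ℂ) * Complex.exp ((Φ (s, t) : ℂ) * Complex.I) := by
  have hc : Continuous (deriv γ) := hγ.continuous_deriv le_rfl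
  set c : ℝ → ℝ := fun t => projIcc 0 L hL t with hcdef
  have hcc : Continuous c := continuous_subtype_val.comp continuous_projIcc
  have hcmem : ∀ t, c t ∈ Icc 0 L := fun t => (projIcc 0 L hL t).2
  have hceq : ∀ t ∈ Icc 0 L, c t = t := fun t ht => by
    simp only [hcdef, projIcc_of_mem hL ht]
  set F : ℝ × ℝ → ℂ := fun p => ∫ u in (0 : ℝ)..1, deriv γ (c p.1 + u * (c p.2 - c p.1))
  have hF : Continuous F :=
    intervalIntegral.continuous_parametric_intervalIntegral_of_continuous'
      (by unfold Function.uncurry; fun_prop) 0 1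
  have hFdiag : ∀ t ∈ Icc 0 L, F (t, t) = deriv γ t := by
    intro t ht
    simp [F, hceq t ht]
  have hFsub : ∀ s t, ((c t - c s : ℝ) : ℂ) * F (s, t) = γ (c t) - γ (c s) := fun s t =>
    sub_mul_integral_deriv_segment hγ _ _
  have hne : ∀ p, F p ≠ 0 := by
    rintro ⟨s, t⟩ h0
    by_cases hst : c s = c t
    · have : F (s, t) = deriv γ (c s) := by simp [F, hst]
      rw [this, hlift _ (hcmem s)] at h0
      exact Complex.exp_ne_zero _ h0
    · have := hFsub s t
      rw [h0, mul_zero] at this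
      exact hst (hinj (hcmem s) (hcmem t) (sub_eq_zero.1 this.symm).symm)
  obtain ⟨f, hf, hfF⟩ := exists_continuous_exp_eq hF hne
  have hpolar : ∀ p, F p = ((Real.exp (f p).re : ℝ) : ℂ) *
      Complex.exp (((f p).im : ℂ) * Complex.I) := by
    intro p
    rw [← hfF p, Complex.ofReal_exp, ← Complex.exp_add, Complex.re_add_im]
  have hdiag : ∀ t ∈ Icc 0 L, ∃ n : ℤ, (f (t, t)).im - θ t = 2 * π * n := by
    intro t ht
    rw [← exp_mul_I_eq_iff_exists_int, ← hlift t ht, ← hFdiag t ht]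
    have h1 := hpolar (t, t)
    have h2 : ‖F (t, t)‖ = 1 := by
      rw [hFdiag t ht, hlift t ht, Complex.norm_exp_ofReal_mul_I]
    rw [h1, norm_mul, Complex.norm_exp_ofReal_mul_I, mul_one, Complex.norm_real,
      Real.norm_of_nonneg (Real.exp_pos _).le] at h2
    rw [h1, h2, Complex.ofReal_one, one_mul]
  have h0L : (0 : ℝ) ∈ Icc 0 L := ⟨le_rfl, hL⟩
  obtain ⟨n, hn⟩ := hdiag 0 h0L
  refine ⟨fun p => (f p).im - 2 * π * n, fun p => Real.exp (f p).re, by fun_prop,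
    fun p => Real.exp_pos _, fun t ht => ?_, fun s hs t ht => ?_⟩
  · have := eq_of_continuousOn_of_forall_two_pi_int (f := fun t => (f (t, t)).im - θ t)
      isPreconnected_Icc (ContinuousOn.sub (by fun_prop) hθ) hdiag ht h0L
    linarith
  · have h1 := hFsub s t
    rw [hceq s hs, hceq t ht, hpolar] at h1
    have h2 : Complex.exp ((((f (s, t)).im - 2 * π * n : ℝ) : ℂ) * Complex.I) =
        Complex.exp (((f (s, t)).im : ℂ) * Complex.I) :=
      exp_mul_I_eq_iff_exists_int.2 ⟨-n, by push_cast; ring⟩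
    rw [← h1, h2, Complex.ofReal_mul, mul_assoc]

/-- The derivative of the tangent angle is the curvature. -/
lemma hasDerivAt_tangent_angle {γ : ℝ → ℂ} {θ : ℝ → ℝ} {L t : ℝ} (hγ : ContDiff ℝ 2 γ)
    (hθ : ContinuousOn θ (Icc 0 L))
    (hlift : ∀ t ∈ Icc 0 L, deriv γ t = Complex.exp ((θ t : ℂ) * Complex.I))
    (ht : t ∈ Ioo 0 L) : HasDerivAt θ (curvU γ t) t := by
  have hpi := Real.pi_pos
  have hnhds : Icc 0 L ∈ nhds t := Icc_mem_nhds ht.1 ht.2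
  have htI : t ∈ Icc 0 L := Ioo_subset_Icc_self ht
  have hd : HasDerivAt (deriv γ) (deriv (deriv γ) t) t :=
    ((hγ.differentiable_deriv_two) t).hasDerivAt
  set E := Complex.exp ((θ t : ℂ) * Complex.I) with hE
  have hE0 : E ≠ 0 := Complex.exp_ne_zero _
  have hw : HasDerivAt (fun x => deriv γ x / E) (deriv (deriv γ) t / E) t := hd.div_const E
  have hw1 : deriv γ t / E = 1 := by rw [hlift t htI, div_self hE0]
  have hlog : HasDerivAt (fun x => Complex.log (deriv γ x / E))
      ((deriv (deriv γ) t / E) / (deriv γ t / E)) t :=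
    hw.clog_real (by rw [hw1]; exact Complex.one_mem_slitPlane)
  have him := (Complex.imCLM.hasFDerivAt.comp_hasDerivAt t hlog).add_const (θ t)
  have heq : θ =ᶠ[nhds t] fun x => (Complex.log (deriv γ x / E)).im + θ t := by
    have hclose : ∀ᶠ x in nhds t, θ x - θ t ∈ Ioo (-π) π := by
      have : ContinuousAt (fun x => θ x - θ t) t :=
        (hθ.continuousAt hnhds).sub continuousAt_const
      apply this.eventually_mem
      simp only [sub_self]
      exact Ioo_mem_nhds (by linarith) hpi
    filter_upwards [hclose, hnhds] with x hx hxI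
    have : deriv γ x / E = Complex.exp (((θ x - θ t : ℝ) : ℂ) * Complex.I) := by
      rw [hlift x hxI, hE, ← Complex.exp_sub]
      congr 1
      push_cast
      ring
    rw [this, Complex.log_exp (by simpa using hx.1) (by simpa using hx.2.le)]
    simp
  refine (him.congr_of_eventuallyEq heq).congr_deriv ?_
  have hn : E.re * E.re + E.im * E.im = 1 := by
    have h1 := Complex.norm_exp_ofReal_mul_I (θ t)
    rw [← hE, ← sq_eq_sq₀ (norm_nonneg _) zero_le_one, Complex.sq_norm,
      Complex.normSq_apply] at h1
    linarith
  rw [hw1, div_one]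
  simp only [Complex.imCLM_apply, Complex.div_im, curvU, inner2, hlift t htI, ← hE,
    Complex.normSq_apply, hn, Complex.mul_re, Complex.mul_im, Complex.I_re, Complex.I_im]
  ring

/-- The highest point of the arc lies strictly between its endpoints, and the tangent there points
in the negative direction of the axis. -/
lemma exists_max_height_tangent_angle {γ : ℝ → ℂ} {θ : ℝ → ℝ} {L : ℝ} (hL : 0 < L)
    (hγ : ContDiff ℝ 2 γ) (hcurv : ∀ t ∈ Icc 0 L, 0 < curvU γ t)
    (hlift : ∀ t ∈ Icc 0 L, deriv γ t = Complex.exp ((θ t : ℂ) * Complex.I))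
    (h0 : (γ 0).im = 0) (h1 : (γ L).im = 0) (hup : 0 < Real.sin (θ 0)) :
    ∃ T ∈ Ioo 0 L, (∀ t ∈ Icc 0 L, (γ t).im ≤ (γ T).im) ∧ ∃ j : ℤ, θ T = 2 * π * j + π := by
  have hdγ : ∀ x, HasDerivAt (fun t => (γ t).im) (deriv γ x).im x := fun x =>
    Complex.imCLM.hasFDerivAt.comp_hasDerivAt x
      ((hγ.differentiable two_ne_zero) x).hasDerivAt
  have hdd : ∀ x, HasDerivAt (fun t => (deriv γ t).im) (deriv (deriv γ) x).im x := fun x =>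
    Complex.imCLM.hasFDerivAt.comp_hasDerivAt x ((hγ.differentiable_deriv_two) x).hasDerivAt
  have hderiv : deriv (fun t => (γ t).im) = fun t => (deriv γ t).im :=
    funext fun x => (hdγ x).deriv
  obtain ⟨T, hTI, hT⟩ := isCompact_Icc.exists_isMaxOn (nonempty_Icc.2 hL.le)
    (Complex.continuous_im.comp hγ.continuous).continuousOn
  have hmax : ∀ t ∈ Icc 0 L, (γ t).im ≤ (γ T).im := fun t ht => hT ht
  have hpos : 0 < (γ T).im := by
    have hs := (hdγ 0).tendsto_slope_zero_right
    rw [hlift 0 ⟨le_rfl, hL.le⟩, exp_mul_I_im] at hs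
    have he := (hs.eventually (lt_mem_nhds hup)).and (Ioo_mem_nhdsGT hL)
    obtain ⟨t, ht, htI⟩ := he.exists
    simp only [zero_add, h0, sub_zero, smul_eq_mul] at ht
    have : 0 < (γ t).im := (pos_iff_pos_of_mul_pos ht).1 (inv_pos.2 htI.1)
    exact this.trans_le (hmax t (Ioo_subset_Icc_self htI))
  have hTO : T ∈ Ioo 0 L := by
    refine ⟨lt_of_le_of_ne hTI.1 ?_, lt_of_le_of_ne hTI.2 ?_⟩
    · rintro rfl
      exact hpos.ne' h0
    · rintro rfl
      exact hpos.ne' h1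
  have hloc : IsLocalMax (fun t => (γ t).im) T := hT.isLocalMax (Icc_mem_nhds hTO.1 hTO.2)
  have him0 : (deriv γ T).im = 0 := by
    rw [← (hdγ T).deriv]; exact hloc.deriv_eq_zero
  refine ⟨T, hTO, hmax, ?_⟩
  have hsin : Real.sin (θ T) = 0 := by
    rw [← exp_mul_I_im, ← hlift T hTI, him0]
  have hre : (deriv γ T).re = Real.cos (θ T) := by
    rw [hlift T hTI, Complex.exp_ofReal_mul_I_re]
  have hcos : Real.cos (θ T) = -1 := by
    rcases Real.sin_eq_zero_iff_cos_eq.1 hsin with hc | hc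
    · exfalso
      have hk := hcurv T hTI
      simp only [curvU, inner2, Complex.mul_re, Complex.mul_im, Complex.I_re, Complex.I_im, hre,
        him0, hc] at hk
      have hk' : 0 < (deriv (deriv γ) T).im := by linarith
      have hmin : IsLocalMin (fun t => (γ t).im) T :=
        isLocalMin_of_deriv_deriv_pos (by rw [hderiv, (hdd T).deriv]; exact hk')
          (by rw [hderiv]; exact him0) (hdγ T).continuousAt
      have hconst : (fun t => (γ t).im) =ᶠ[nhds T] fun _ => (γ T).im := by
        filter_upwards [hloc, hmin] with t ha hb using le_antisymm ha hb
      have := hconst.deriv.deriv_eq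
      rw [hderiv, (hdd T).deriv] at this
      simp at this
      exact hk'.ne' this
    · exact hc
  obtain ⟨j, hj⟩ := Real.cos_eq_neg_one_iff.1 hcos
  exact ⟨j, by linarith⟩

/-- A point of the open arc does not lie on the closing segment. -/
lemma ne_ofReal_of_injOn_concatSeg {γ : ℝ → ℂ} {L a : ℝ}
    (hsimple : InjOn (concatSeg γ L a) (Ico 0 (L + 2 * a))) {t x : ℝ} (ht : t ∈ Icc 0 L)
    (hx : x ∈ Ioo (-a) a) : γ t ≠ x := by
  intro h
  have hxL : ¬ L + (x + a) ≤ L := by linarith [hx.1]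
  have h1 : concatSeg γ L a t = concatSeg γ L a (L + (x + a)) := by
    simp only [concatSeg, if_pos ht.2, if_neg hxL, h]
    congr 1
    ring
  have := hsimple ⟨ht.1, by linarith [ht.2, hx.1, hx.2]⟩
    ⟨by linarith [ht.1, ht.2, hx.1], by linarith [hx.2]⟩ h1
  linarith [ht.2, hx.1]

/-- Theorem of turning tangents for an arc from `a` to `-a` which leaves and reaches the axis from
above and whose highest point has tangent angle `π` modulo `2π`. -/
lemma tangent_angle_end_mem_Ioo {γ : ℝ → ℂ} {θ : ℝ → ℝ} {L a T : ℝ} (ha : 0 < a)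
    (hγ : ContDiff ℝ 1 γ) (hθ : ContinuousOn θ (Icc 0 L))
    (hlift : ∀ t ∈ Icc 0 L, deriv γ t = Complex.exp ((θ t : ℂ) * Complex.I))
    (h0 : γ 0 = (a : ℂ)) (h1 : γ L = (-a : ℂ))
    (hsimple : InjOn (concatSeg γ L a) (Ico 0 (L + 2 * a)))
    (hup : θ 0 ∈ Ioo 0 π) (hdown : Real.sin (θ L) ≠ 0) (hT : T ∈ Ioo 0 L)
    (hmax : ∀ t ∈ Icc 0 L, (γ t).im ≤ (γ T).im) {j : ℤ} (hj : θ T = 2 * π * j + π) :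
    θ L ∈ Ioo π (3 * π) := by
  have hpi := Real.pi_pos
  have hL : 0 < L := hT.1.trans hT.2
  have h0I : (0 : ℝ) ∈ Icc 0 L := ⟨le_rfl, hL.le⟩
  have hLI : L ∈ Icc 0 L := ⟨hL.le, le_rfl⟩
  have hTI : T ∈ Icc 0 L := Ioo_subset_Icc_self hT
  have hinj : InjOn γ (Icc 0 L) := by
    intro s hs t ht hst
    refine hsimple ⟨hs.1, by linarith [hs.2]⟩ ⟨ht.1, by linarith [ht.2]⟩ ?_
    simp only [concatSeg, if_pos hs.2, if_pos ht.2, hst]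
  obtain ⟨Φ, R, hΦ, hR, hdiag, hsec⟩ := exists_secant_angle hL.le hγ hinj hθ hlift
  have him : ∀ s ∈ Icc 0 L, ∀ t ∈ Icc 0 L,
      (γ t).im - (γ s).im = (t - s) * R (s, t) * Real.sin (Φ (s, t)) := by
    intro s hs t ht
    rw [← Complex.sub_im, hsec s hs t ht, Complex.im_ofReal_mul, exp_mul_I_im]
  have hbefore : Φ (0, T) - 2 * π * j ∈ Icc 0 π := by
    refine mem_Icc_zero_pi_of_sin_nonneg (f := fun s => Φ (s, T) - 2 * π * j)
      (isPreconnected_Icc (a := 0) (b := T)) (by fun_prop) (fun s hs => ?_)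
      (right_mem_Icc.2 hT.1.le) ?_ (left_mem_Icc.2 hT.1.le)
    · have hsI : s ∈ Icc 0 L := ⟨hs.1, hs.2.trans hT.2.le⟩
      rw [mul_comm (2 * π) (j : ℝ), Real.sin_sub_int_mul_two_pi]
      rcases hs.2.eq_or_lt with rfl | hlt
      · rw [hdiag s hTI, hj, mul_comm (2 * π) (j : ℝ), add_comm, Real.sin_add_int_mul_two_pi,
          Real.sin_pi]
      · have h2 := him s hsI T hTI
        have h3 := hmax s hsI
        exact nonneg_of_mul_nonneg_right (h2 ▸ sub_nonneg.2 h3)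
          (mul_pos (sub_pos.2 hlt) (hR _))
    · simp only [hdiag T hTI, hj]
      constructor <;> linarith
  have hafter : Φ (T, L) - 2 * π * j - π ∈ Icc 0 π := by
    refine mem_Icc_zero_pi_of_sin_nonneg (f := fun t => Φ (T, t) - 2 * π * j - π)
      (isPreconnected_Icc (a := T) (b := L)) (by fun_prop) (fun t ht => ?_)
      (left_mem_Icc.2 hT.2.le) ?_ (right_mem_Icc.2 hT.2.le)
    · have htI : t ∈ Icc 0 L := ⟨hT.1.le.trans ht.1, ht.2⟩
      rw [Real.sin_sub_pi, mul_comm (2 * π) (j : ℝ), Real.sin_sub_int_mul_two_pi]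
      rcases ht.1.eq_or_lt with rfl | hlt
      · rw [hdiag T hTI, hj, mul_comm (2 * π) (j : ℝ), add_comm, Real.sin_add_int_mul_two_pi,
          Real.sin_pi, neg_zero]
      · have h2 := him T hTI t htI
        have h3 := hmax t htI
        have h4 : 0 < (t - T) * R (T, t) := mul_pos (sub_pos.2 hlt) (hR _)
        by_contra! hneg
        nlinarith
    · simp only [hdiag T hTI, hj]
      constructor <;> linarith
  have hnever : ∀ t ∈ Icc 0 L, ∀ k : ℤ, Φ (0, t) - Φ (t, L) ≠ 2 * π * k := by
    intro t ht k hk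
    have hdir := exp_mul_I_eq_iff_exists_int.2 ⟨k, hk⟩
    have hs1 := hsec 0 h0I t ht
    have hs2 := hsec t ht L hLI
    rw [← hdir] at hs2
    set E := Complex.exp ((Φ (0, t) : ℂ) * Complex.I) with hE
    set p := (t - 0) * R (0, t) with hp
    set r := (L - t) * R (t, L) with hr
    rw [h0] at hs1
    rw [h1] at hs2
    have hp0 : 0 ≤ p := mul_nonneg (by linarith [ht.1]) (hR _).le
    have hr0 : 0 ≤ r := mul_nonneg (by linarith [ht.2]) (hR _).le
    have hre1 : (γ t).re - a = p * E.re := by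
      have := congrArg Complex.re hs1
      rwa [Complex.sub_re, Complex.ofReal_re, Complex.re_ofReal_mul] at this
    have him1 : (γ t).im = p * E.im := by
      have := congrArg Complex.im hs1
      rwa [Complex.sub_im, Complex.ofReal_im, sub_zero, Complex.im_ofReal_mul] at this
    have hre2 : -a - (γ t).re = r * E.re := by
      have := congrArg Complex.re hs2
      rwa [Complex.sub_re, Complex.neg_re, Complex.ofReal_re, Complex.re_ofReal_mul] at this
    have him2 : -(γ t).im = r * E.im := by
      have := congrArg Complex.im hs2
      rwa [Complex.sub_im, Complex.neg_im, Complex.ofReal_im, neg_zero, zero_sub,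
        Complex.im_ofReal_mul] at this
    have hpr : p + r ≠ 0 := by
      intro h
      have : (p + r) * E.re = -2 * a := by linarith
      rw [h, zero_mul] at this
      linarith
    have hEim : E.im = 0 := by
      have : (p + r) * E.im = 0 := by linarith
      exact (mul_eq_zero.1 this).resolve_left hpr
    have hsinE : Real.sin (Φ (0, t)) = 0 := by rw [← exp_mul_I_im, ← hE, hEim]
    rcases ht.1.eq_or_lt with rfl | ht0
    · rw [hdiag 0 h0I] at hsinE
      exact (Real.sin_pos_of_mem_Ioo hup).ne' hsinE
    rcases ht.2.eq_or_lt with rfl | htL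
    · apply hdown
      rw [← hdiag t hLI, ← exp_mul_I_im, ← hdir, hEim]
    have hp' : 0 < p := mul_pos (by linarith) (hR _)
    have hr' : 0 < r := mul_pos (by linarith) (hR _)
    have hEre : E.re < 0 := by
      by_contra! h
      nlinarith [mul_nonneg hp0 h, mul_nonneg hr0 h]
    refine ne_ofReal_of_injOn_concatSeg hsimple ht (x := (γ t).re) ⟨?_, ?_⟩ ?_
    · nlinarith [mul_neg_of_pos_of_neg hr' hEre]
    · nlinarith [mul_neg_of_pos_of_neg hp' hEre]
    · apply Complex.ext
      · simp
      · simp [him1, hEim]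
  have hμ : ContinuousOn (fun t => Φ (0, t) - Φ (t, L)) (Icc 0 L) := by fun_prop
  have hμT : Φ (0, T) - Φ (T, L) ∈ Icc (-(2 * π)) 0 :=
    ⟨by linarith [hbefore.1, hafter.2], by linarith [hbefore.2, hafter.1]⟩
  have hrange : ∀ t ∈ Icc 0 L, Φ (0, t) - Φ (t, L) ∈ Ioo (-(2 * π)) 0 := by
    intro t ht
    constructor
    · by_contra! hle
      obtain ⟨z, hz, hfz⟩ := isPreconnected_Icc.intermediate_value ht hTI hμ ⟨hle, hμT.1⟩
      exact hnever z hz (-1) (by simpa using hfz)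
    · by_contra! hle
      obtain ⟨z, hz, hfz⟩ := isPreconnected_Icc.intermediate_value hTI ht hμ ⟨hμT.2, hle⟩
      exact hnever z hz 0 (by simpa using hfz)
  have hr0 := hrange 0 h0I
  have hrL := hrange L hLI
  rw [hdiag 0 h0I] at hr0
  rw [hdiag L hLI] at hrL
  have hchord := hsec 0 h0I L hLI
  rw [h0, h1] at hchord
  have hLR : 0 < (L - 0) * R (0, L) := mul_pos (by linarith) (hR _)
  have hcos : Real.cos (Φ (0, L)) < 0 := by
    have := congrArg Complex.re hchord
    rw [Complex.re_ofReal_mul, Complex.exp_ofReal_mul_I_re] at this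
    simp only [Complex.sub_re, Complex.neg_re, Complex.ofReal_re] at this
    by_contra! h
    nlinarith [mul_nonneg hLR.le h]
  have hsin : Real.sin (Φ (0, L)) = 0 := by
    have := congrArg Complex.im hchord
    rw [Complex.im_ofReal_mul, exp_mul_I_im] at this
    rw [Complex.sub_im, Complex.neg_im, Complex.ofReal_im, neg_zero, sub_self] at this
    exact (mul_eq_zero.1 this.symm).resolve_left hLR.ne'
  have hcos1 : Real.cos (Φ (0, L)) = -1 := by
    rcases Real.sin_eq_zero_iff_cos_eq.1 hsin with h | h
    · linarith
    · exact h
  obtain ⟨m, hm⟩ := Real.cos_eq_neg_one_iff.1 hcos1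
  have hm0 : m = 0 := by
    have h2 : (m : ℝ) < 1 := by nlinarith [hr0.1, hup.2]
    have h3 : (-1 : ℝ) < m := by nlinarith [hr0.2, hup.1]
    have h2' : m < 1 := by exact_mod_cast h2
    have h3' : -1 < m := by exact_mod_cast h3
    omega
  rw [hm0, Int.cast_zero, zero_mul, add_zero] at hm
  exact ⟨by linarith [hrL.2], by linarith [hrL.1]⟩

theorem stmt1 (a L θ₀ θL : ℝ) (ha : 0 < a) (hL : 0 < L) (γ : ℝ → ℂ) (θ : ℝ → ℝ)
    (hγ : ContDiff ℝ 2 γ)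
    (hunit : ∀ t ∈ Icc 0 L, ‖deriv γ t‖ = 1)
    (hcurv : ∀ t ∈ Icc 0 L, 0 < curvU γ t)
    (h0 : γ 0 = (a : ℂ)) (h1 : γ L = (-a : ℂ))
    (hsimple : Set.InjOn (concatSeg γ L a) (Ico 0 (L + 2 * a)))
    (hθ0 : π / 2 ≤ θ₀) (hθ0' : θ₀ < π) (hθL : π < θL) (hθL' : θL ≤ 3 * π / 2)
    (hd0 : deriv γ 0 = Complex.exp ((θ₀ : ℂ) * Complex.I))
    (hdL : deriv γ L = Complex.exp ((θL : ℂ) * Complex.I))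
    (hθcont : ContinuousOn θ (Icc 0 L))
    (hθlift : ∀ t ∈ Icc 0 L, deriv γ t = Complex.exp ((θ t : ℂ) * Complex.I))
    (hθinit : θ 0 = θ₀) :
    θ L = θL ∧ StrictMonoOn θ (Icc 0 L) ∧ (∀ t ∈ Icc 0 L, θ t ∈ Icc θ₀ θL) ∧
      StrictAntiOn (fun t => (γ t).re) (Icc 0 L) := by
  have hpi := Real.pi_pos
  have h0I : (0 : ℝ) ∈ Icc 0 L := ⟨le_rfl, hL.le⟩
  have hLI : L ∈ Icc 0 L := ⟨hL.le, le_rfl⟩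
  have hmono : StrictMonoOn θ (Icc 0 L) := by
    refine strictMonoOn_of_deriv_pos (convex_Icc 0 L) hθcont fun t ht => ?_
    rw [interior_Icc] at ht
    rw [(hasDerivAt_tangent_angle hγ hθcont hθlift ht).deriv]
    exact hcurv t (Ioo_subset_Icc_self ht)
  have hup : θ 0 ∈ Ioo 0 π := by rw [hθinit]; exact ⟨by linarith, hθ0'⟩
  obtain ⟨n, hn⟩ := exp_mul_I_eq_iff_exists_int.1 ((hθlift L hLI).symm.trans hdL)
  have hdown : Real.sin (θ L) ≠ 0 := by
    have h2 : Real.sin (θL - π) = -Real.sin θL := Real.sin_sub_pi _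
    have h3 : 0 < Real.sin (θL - π) :=
      Real.sin_pos_of_pos_of_lt_pi (by linarith) (by linarith)
    rw [← exp_mul_I_im, ← hθlift L hLI, hdL, exp_mul_I_im]
    linarith
  obtain ⟨T, hT, hmax, j, hj⟩ := exists_max_height_tangent_angle hL hγ hcurv hθlift
    (by simp [h0]) (by simp [h1]) (Real.sin_pos_of_mem_Ioo hup)
  have hend := tangent_angle_end_mem_Ioo ha (hγ.of_le one_le_two) hθcont hθlift h0 h1 hsimple
    hup hdown hT hmax hj
  have hθend : θ L = θL := by
    have h2 : (n : ℝ) < 1 := by nlinarith [hend.2]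
    have h3 : (-1 : ℝ) < n := by nlinarith [hend.1]
    have h2' : n < 1 := by exact_mod_cast h2
    have h3' : -1 < n := by exact_mod_cast h3
    have hn0 : n = 0 := by omega
    rw [hn0, Int.cast_zero, mul_zero] at hn
    linarith
  refine ⟨hθend, hmono, fun t ht => ⟨?_, ?_⟩, ?_⟩
  · rw [← hθinit]
    exact hmono.monotoneOn h0I ht ht.1
  · rw [← hθend]
    exact hmono.monotoneOn ht hLI ht.2
  · refine strictAntiOn_of_deriv_neg (convex_Icc 0 L)
      (Complex.continuous_re.comp hγ.continuous).continuousOn fun t ht => ?_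
    rw [interior_Icc] at ht
    have htI := Ioo_subset_Icc_self ht
    have hd : HasDerivAt (fun t => (γ t).re) (deriv γ t).re t :=
      Complex.reCLM.hasFDerivAt.comp_hasDerivAt t
        ((hγ.differentiable two_ne_zero) t).hasDerivAt
    rw [hd.deriv, hθlift t htI, Complex.exp_ofReal_mul_I_re]
    have h2 := hmono h0I htI ht.1
    have h3 := hmono htI hLI ht.2
    exact Real.cos_neg_of_pi_div_two_lt_of_lt (by linarith) (by linarith)
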